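/- With Y = Σ_{j=1}^r a_j⁻¹ O_j, the shadow estimator is unbiased on the visible space: E[ô] = Σ_{g∈G} Σ_{i=1}^d p(g,i) ô(g,i) = Tr[ρ O]. -/

import Mathlib

open Matrix
open scoped BigOperators ComplexOrder

noncomputable section

/-- Conjugation `X ↦ U X U*` as a linear endomorphism of `End(ℂ^d)`. -/
def conjMap {d : ℕ} (U : Matrix (Fin d) (Fin d) ℂ) :
    Matrix (Fin d) (Fin d) ℂ →ₗ[ℂ] Matrix (Fin d) (Fin d) ℂ :=
  (LinearMap.mulLeft ℂ U).comp (LinearMap.mulRight ℂ (star U))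

/-- The probability `p(g,i) = (1/|G|) ⟨w_i, R(g) ρ R(g)* w_i⟩` of the single-shot
outcome `(g, i)`. -/
def prob {G : Type*} [Group G] [Fintype G] {d : ℕ}
    (R : G →* Matrix.unitaryGroup (Fin d) ℂ) (w : Fin d → Fin d → ℂ)
    (ρ : Matrix (Fin d) (Fin d) ℂ) (g : G) (i : Fin d) : ℝ :=
  (((Fintype.card G : ℂ))⁻¹ *
    ∑ x, star (w i x) *
      (((R g : Matrix (Fin d) (Fin d) ℂ) * ρ *
          star (R g : Matrix (Fin d) (Fin d) ℂ)).mulVec (w i)) x).re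

/-- The single-shot estimator value `ô(g,i) = ⟨w_i, R(g) Y R(g)* w_i⟩`. -/
def est {G : Type*} [Group G] [Fintype G] {d : ℕ}
    (R : G →* Matrix.unitaryGroup (Fin d) ℂ) (w : Fin d → Fin d → ℂ)
    (Y : Matrix (Fin d) (Fin d) ℂ) (g : G) (i : Fin d) : ℝ :=
  (∑ x, star (w i x) *
      (((R g : Matrix (Fin d) (Fin d) ℂ) * Y *
          star (R g : Matrix (Fin d) (Fin d) ℂ)).mulVec (w i)) x).re

/-- The mean `E[ô] = Σ_{g,i} p(g,i) ô(g,i)` of the single-shot estimator. -/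
def mean {G : Type*} [Group G] [Fintype G] {d : ℕ}
    (R : G →* Matrix.unitaryGroup (Fin d) ℂ) (w : Fin d → Fin d → ℂ)
    (ρ Y : Matrix (Fin d) (Fin d) ℂ) : ℝ :=
  ∑ g : G, ∑ i : Fin d, prob R w ρ g i * est R w Y g i

/-- The variance `Var[ô] = Σ_{g,i} p(g,i) ô(g,i)² − (E[ô])²` of the single-shot
estimator. -/
def variance {G : Type*} [Group G] [Fintype G] {d : ℕ}
    (R : G →* Matrix.unitaryGroup (Fin d) ℂ) (w : Fin d → Fin d → ℂ)
    (ρ Y : Matrix (Fin d) (Fin d) ℂ) : ℝ :=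
  (∑ g : G, ∑ i : Fin d, prob R w ρ g i * (est R w Y g i) ^ 2) - (mean R w ρ Y) ^ 2

namespace Representation

variable {𝕜 G V : Type*} [Field 𝕜] [Group G] [AddCommGroup V] [Module 𝕜 V]

theorem averageMap_apply [Fintype G] [Invertible (Fintype.card G : 𝕜)]
    (τ : Representation 𝕜 G V) (v : V) :
    τ.averageMap v = (Fintype.card G : 𝕜)⁻¹ • ∑ g, τ g v := by
  simp [averageMap, GroupAlgebra.average, map_sum]

/-- The average over `G` of the conjugates of an endomorphism, `|G|⁻¹ ∑ g, τ g⁻¹ ∘ f ∘ τ g`. -/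
def conjAverage [Fintype G] (τ : Representation 𝕜 G V) (f : Module.End 𝕜 V) : Module.End 𝕜 V :=
  (Fintype.card G : 𝕜)⁻¹ • ∑ g, τ g⁻¹ * f * τ g

theorem conjAverage_commute [Fintype G] (τ : Representation 𝕜 G V) (f : Module.End 𝕜 V) (g : G) :
    Commute (τ.conjAverage f) (τ g) := by
  simp only [conjAverage, Commute, SemiconjBy, smul_mul_assoc, mul_smul_comm, Finset.sum_mul,
    Finset.mul_sum]
  congr 1
  refine Fintype.sum_equiv (Equiv.mulRight g) _ _ fun x => ?_
  have h : τ g * τ (x * g)⁻¹ = τ x⁻¹ := by rw [← map_mul]; simp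
  rw [Equiv.coe_mulRight, ← mul_assoc, ← mul_assoc, h, map_mul, mul_assoc, mul_assoc]

theorem trace_conjAverage [Fintype G] [CharZero 𝕜] (τ : Representation 𝕜 G V)
    (f : Module.End 𝕜 V) :
    LinearMap.trace 𝕜 V (τ.conjAverage f) = LinearMap.trace 𝕜 V f := by
  have h (g : G) : LinearMap.trace 𝕜 V (τ g⁻¹ * f * τ g) = LinearMap.trace 𝕜 V f := by
    rw [mul_assoc, LinearMap.trace_mul_comm, mul_assoc, ← map_mul]
    simp
  simp [conjAverage, h]

/-- **Schur's lemma**: an endomorphism commuting with an irreducible action is the scalar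
determined by its trace. -/
theorem finrank_smul_eq_trace_smul [IsAlgClosed 𝕜] [FiniteDimensional 𝕜 V]
    (τ : Representation 𝕜 G V)
    (hirr : ∀ U : Submodule 𝕜 V, (∀ g, ∀ x ∈ U, τ g x ∈ U) → U = ⊥ ∨ U = ⊤)
    (f : Module.End 𝕜 V) (hf : ∀ g, Commute f (τ g)) (v : V) :
    (Module.finrank 𝕜 V : 𝕜) • f v = LinearMap.trace 𝕜 V f • v := by
  rcases subsingleton_or_nontrivial V with _ | _
  · exact Subsingleton.elim _ _
  obtain ⟨c, hc⟩ := Module.End.exists_eigenvalue f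
  have htop : f.eigenspace c = ⊤ := by
    refine (hirr _ fun g x hx => ?_).resolve_left hc
    rw [Module.End.mem_eigenspace_iff] at hx ⊢
    have := LinearMap.congr_fun (hf g).eq x
    simp only [Module.End.mul_apply] at this
    rw [this, hx, map_smul]
  have hfc : f = c • LinearMap.id := by
    ext x
    exact Module.End.mem_eigenspace_iff.1 (htop ▸ Submodule.mem_top)
  rw [hfc]
  simp [smul_smul, mul_comm]

theorem conjAverage_averageMap_apply [Fintype G] [CharZero 𝕜] [IsAlgClosed 𝕜]
    [FiniteDimensional 𝕜 V] (τ : Representation 𝕜 G V)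
    (hirr : ∀ U : Submodule 𝕜 V, (∀ g, ∀ x ∈ U, τ g x ∈ U) → U = ⊥ ∨ U = ⊤)
    (H : Subgroup G) [Fintype H] [Invertible (Fintype.card H : 𝕜)] (v : V) :
    (Module.finrank 𝕜 V : 𝕜) • τ.conjAverage (averageMap (τ.comp H.subtype)) v =
      (Module.finrank 𝕜 (invariants (τ.comp H.subtype)) : 𝕜) • v := by
  rw [finrank_smul_eq_trace_smul τ hirr _ (τ.conjAverage_commute _), trace_conjAverage,
    (isProj_averageMap _).trace]

/-- On an irreducible invariant subspace `W`, conjugation-averaging the projection to the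
`H`-invariants is multiplication by `dim W^H / dim W`. -/
theorem conjAverage_averageMap_apply_of_mem [Fintype G] [CharZero 𝕜] [IsAlgClosed 𝕜]
    (τ : Representation 𝕜 G V) (W : Submodule 𝕜 V) [FiniteDimensional 𝕜 W]
    (hW : ∀ g, ∀ x ∈ W, τ g x ∈ W)
    (hirr : ∀ U ≤ W, (∀ g, ∀ x ∈ U, τ g x ∈ U) → U = ⊥ ∨ U = W)
    (H : Subgroup G) [Fintype H] [Invertible (Fintype.card H : 𝕜)] {v : V} (hv : v ∈ W) :
    (Module.finrank 𝕜 W : 𝕜) • τ.conjAverage (averageMap (τ.comp H.subtype)) v =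
      (Module.finrank 𝕜 ↥(W ⊓ invariants (τ.comp H.subtype)) : 𝕜) • v := by
  let σ : Representation 𝕜 G W := τ.subrepresentation W fun g x hx => hW g x hx
  have hσ (g : G) (x : W) : (σ g x : V) = τ g x := rfl
  have hσirr (U : Submodule 𝕜 W) (hU : ∀ g, ∀ x ∈ U, σ g x ∈ U) : U = ⊥ ∨ U = ⊤ := by
    have h := hirr (U.map W.subtype) (Submodule.map_subtype_le W U) <| by
      rintro g _ ⟨x, hx, rfl⟩
      exact ⟨σ g x, hU g x hx, rfl⟩
    refine h.imp (fun h => ?_) fun h => ?_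
    · apply Submodule.map_injective_of_injective W.injective_subtype
      rw [h, Submodule.map_bot]
    · apply Submodule.map_injective_of_injective W.injective_subtype
      rw [h, Submodule.map_subtype_top]
  have hinv : invariants (σ.comp H.subtype) =
      (invariants (τ.comp H.subtype)).comap W.subtype := by
    ext x
    simp [Subtype.ext_iff, hσ]
  have key := congrArg W.subtype (σ.conjAverage_averageMap_apply hσirr H ⟨v, hv⟩)
  rw [hinv, ← Submodule.finrank_map_subtype_eq, Submodule.map_comap_subtype] at key
  have havg (x : W) : (averageMap (σ.comp H.subtype) x : V) =
      averageMap (τ.comp H.subtype) (x : V) := by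
    simp only [averageMap_apply]
    simp [hσ]
  simpa [conjAverage, hσ, havg, -averageMap] using key

end Representation

/-- The representation of `G` on matrices by conjugation. -/
def conjRep {G : Type*} [Group G] {d : ℕ} (R : G →* Matrix.unitaryGroup (Fin d) ℂ) :
    Representation ℂ G (Matrix (Fin d) (Fin d) ℂ) where
  toFun g := conjMap (R g : Matrix (Fin d) (Fin d) ℂ)
  map_one' := by ext1 X; simp [conjMap]
  map_mul' g h := by ext1 X; simp [conjMap, mul_assoc]

theorem conjRep_apply {G : Type*} [Group G] {d : ℕ} (R : G →* Matrix.unitaryGroup (Fin d) ℂ)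
    (g : G) (X : Matrix (Fin d) (Fin d) ℂ) :
    conjRep R g X = (R g : Matrix (Fin d) (Fin d) ℂ) * X *
      star (R g : Matrix (Fin d) (Fin d) ℂ) := by
  simp [conjRep, conjMap, mul_assoc]

/-- The diagonal part of a matrix with respect to the orthonormal basis formed by the columns
of `A`. -/
def dephase {d : ℕ} (A X : Matrix (Fin d) (Fin d) ℂ) : Matrix (Fin d) (Fin d) ℂ :=
  A * diagonal (Aᴴ * X * A).diag * Aᴴ

theorem sum_diag_mul_diag {d : ℕ} (A X Y : Matrix (Fin d) (Fin d) ℂ) :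
    ∑ i, (Aᴴ * X * A) i i * (Aᴴ * Y * A) i i = (X * dephase A Y).trace := by
  rw [dephase, ← mul_assoc, Matrix.trace_mul_comm, ← mul_assoc, ← mul_assoc, Matrix.trace]
  simp [mul_diagonal]

/-- Orthogonality of unitary characters of a finite group. -/
theorem sum_mul_star_eq {K : Type*} [Group K] [Fintype K] (φ ψ : K →* ℂ) [Decidable (φ = ψ)]
    (hψ : ∀ h, ψ h * star (ψ h) = 1) :
    ∑ h, φ h * star (ψ h) = if φ = ψ then (Fintype.card K : ℂ) else 0 := by
  split_ifs with h
  · simp only [h, hψ]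
    simp
  · let θ : K →* ℂ := φ * (starRingEnd ℂ : ℂ →* ℂ).comp ψ
    refine sum_hom_units_eq_zero θ fun hθ => h ?_
    ext x
    have h1 : φ x * star (ψ x) = 1 := DFunLike.congr_fun hθ x
    calc φ x = φ x * (ψ x * star (ψ x)) := by rw [hψ, mul_one]
      _ = ψ x := by rw [mul_left_comm, h1, mul_one]

theorem averageMap_conjRep_eq_dephase {K : Type*} [Group K] [Fintype K] {d : ℕ}
    [Invertible (Fintype.card K : ℂ)]
    (R : K →* Matrix.unitaryGroup (Fin d) ℂ) (A : Matrix (Fin d) (Fin d) ℂ) (hA : Aᴴ * A = 1)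
    (χ : Fin d → K → ℂ)
    (heig : ∀ h, (R h : Matrix (Fin d) (Fin d) ℂ) * A = A * diagonal fun i => χ i h)
    (X : Matrix (Fin d) (Fin d) ℂ)
    (hX : ∀ i j, i ≠ j → χ i = χ j → (Aᴴ * X * A) i j = 0) :
    (conjRep R).averageMap X = dephase A X := by
  classical
  have hA' : A * Aᴴ = 1 := mul_eq_one_comm.1 hA
  have hR (h : K) : (R h : Matrix (Fin d) (Fin d) ℂ) = A * diagonal (fun i => χ i h) * Aᴴ := by
    rw [← heig, mul_assoc, hA', mul_one]
  have hdiag (h : K) : Aᴴ * (R h : Matrix (Fin d) (Fin d) ℂ) * A = diagonal fun i => χ i h := by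
    rw [mul_assoc, heig, ← mul_assoc, hA, one_mul]
  have hone (i : Fin d) : χ i 1 = 1 := by
    have := congrFun₂ (hdiag 1) i i
    simpa [hA] using this.symm
  have hmul (i : Fin d) (h h' : K) : χ i (h * h') = χ i h * χ i h' := by
    have e : (diagonal fun i => χ i (h * h')) =
        (diagonal fun i => χ i h) * diagonal fun i => χ i h' := by
      rw [← hdiag h, mul_assoc, ← heig, ← hdiag]
      simp [mul_assoc]
    simpa using congrFun₂ e i i
  have hunit (i : Fin d) (h : K) : χ i h * star (χ i h) = 1 := by
    have e : (diagonal fun i => χ i h) * (diagonal fun i => χ i h)ᴴ = 1 := by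
      rw [← hdiag h]
      simp only [conjTranspose_mul, conjTranspose_conjTranspose, ← mul_assoc]
      rw [mul_assoc _ A, hA', mul_one, mul_assoc _ (R h : Matrix (Fin d) (Fin d) ℂ),
        ← star_eq_conjTranspose (R h : Matrix (Fin d) (Fin d) ℂ),
        (Unitary.mem_iff.1 (R h).2).2, mul_one, hA]
    simpa [diagonal_conjTranspose] using congrFun₂ e i i
  let ψ (i : Fin d) : K →* ℂ := ⟨⟨χ i, hone i⟩, hmul i⟩
  have hψ (i j : Fin d) : ψ i = ψ j ↔ χ i = χ j :=
    ⟨fun h => congrArg (fun f : K →* ℂ => (f : K → ℂ)) h, fun h => by ext x; exact congrFun h x⟩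
  have hentry (h : K) (i j : Fin d) : (Aᴴ * conjRep R h X * A) i j =
      (ψ i h * star (ψ j h)) * (Aᴴ * X * A) i j := by
    have e : Aᴴ * conjRep R h X * A =
        (diagonal fun i => χ i h) * (Aᴴ * X * A) * (diagonal fun i => star (χ i h)) := by
      have e1 : Aᴴ * (R h : Matrix (Fin d) (Fin d) ℂ) = (diagonal fun i => χ i h) * Aᴴ := by
        rw [hR, mul_assoc, ← mul_assoc, hA, one_mul]
      have e2 : star (R h : Matrix (Fin d) (Fin d) ℂ) * A =
          A * diagonal fun i => star (χ i h) := by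
        have := congrArg conjTranspose e1
        simpa [diagonal_conjTranspose, star_eq_conjTranspose, Pi.star_def] using this
      rw [conjRep_apply, mul_assoc, mul_assoc _ _ A, e2, ← mul_assoc, ← mul_assoc, ← mul_assoc, e1]
      simp only [mul_assoc]
    rw [e, mul_diagonal, diagonal_mul]
    change χ i h * _ * star (χ j h) = χ i h * star (χ j h) * _
    ring
  have hcard : (Fintype.card K : ℂ) ≠ 0 := by simp
  have key : Aᴴ * (conjRep R).averageMap X * A = diagonal (Aᴴ * X * A).diag := by
    ext i j
    rw [Representation.averageMap_apply]
    simp only [mul_smul_comm, smul_mul_assoc, Finset.mul_sum, Finset.sum_mul, Matrix.smul_apply,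
      Matrix.sum_apply, hentry, smul_eq_mul]
    rw [← Finset.mul_sum, ← Finset.sum_mul, sum_mul_star_eq _ _ (hunit j)]
    simp only [hψ]
    by_cases hij : i = j
    · subst hij
      simp [hcard]
    · rw [diagonal_apply_ne _ hij]
      by_cases hχ : χ i = χ j
      · simp [hX i j hij hχ]
      · simp [hχ]
  rw [dephase, ← key]
  calc _ = (A * Aᴴ) * (conjRep R).averageMap X * (A * Aᴴ) := by simp [hA']
    _ = _ := by simp only [mul_assoc]

theorem sum_star_mul_mulVec {d : ℕ} (w : Fin d → Fin d → ℂ) (N : Matrix (Fin d) (Fin d) ℂ)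
    (i j : Fin d) :
    ∑ x, star (w i x) * (N *ᵥ w j) x = ((of w)ᵀᴴ * N * (of w)ᵀ) i j := by
  rw [mul_assoc, mul_apply]
  simp [mul_apply, mulVec, dotProduct]

theorem ofReal_mean {G : Type*} [Group G] [Fintype G] {d : ℕ}
    (R : G →* Matrix.unitaryGroup (Fin d) ℂ) (w : Fin d → Fin d → ℂ)
    {ρ Y : Matrix (Fin d) (Fin d) ℂ} (hρ : ρ.IsHermitian) (hY : Y.IsHermitian) :
    (mean R w ρ Y : ℂ) = (Fintype.card G : ℂ)⁻¹ *
      ∑ g, (conjRep R g ρ * dephase (of w)ᵀ (conjRep R g Y)).trace := by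
  have hre {X : Matrix (Fin d) (Fin d) ℂ} (hX : X.IsHermitian) (g : G) (i : Fin d) :
      ((((of w)ᵀᴴ * conjRep R g X * (of w)ᵀ) i i).re : ℂ) =
        ((of w)ᵀᴴ * conjRep R g X * (of w)ᵀ) i i := by
    refine IsHermitian.coe_re_apply_self ?_ i
    rw [conjRep_apply]
    exact isHermitian_conjTranspose_mul_mul _ (isHermitian_mul_mul_conjTranspose _ hX)
  have hc : (Fintype.card G : ℂ)⁻¹ = (((Fintype.card G : ℝ)⁻¹ : ℝ) : ℂ) := by simp
  simp only [mean, prob, est, sum_star_mul_mulVec, ← conjRep_apply, ← sum_diag_mul_diag]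
  rw [hc]
  simp only [Complex.re_ofReal_mul]
  push_cast
  simp only [hre hρ, hre hY, Finset.mul_sum, ← mul_assoc (_ : ℂ)]

theorem trace_conjRep_mul {G : Type*} [Group G] {d : ℕ}
    (R : G →* Matrix.unitaryGroup (Fin d) ℂ) (g : G) (X Y : Matrix (Fin d) (Fin d) ℂ) :
    (conjRep R g X * Y).trace = (X * conjRep R g⁻¹ Y).trace := by
  have h : (R g⁻¹ : Matrix (Fin d) (Fin d) ℂ) = star (R g : Matrix (Fin d) (Fin d) ℂ) := by
    rw [map_inv]
    rfl
  rw [conjRep_apply, conjRep_apply, h, star_star]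
  rw [mul_assoc, mul_assoc, Matrix.trace_mul_comm]
  simp only [mul_assoc]

/-- In the NDCSE setting, with `O = Σ_j O_j` supported on visible
irreducible subspaces `W_j` with visibility coefficients `a_j > 0`, the shadow estimator
built from `Y = Σ_j a_j⁻¹ O_j` is unbiased: `E[ô] = Tr[ρ O]`. -/
theorem shadow_estimator_unbiased
    (G : Type*) [Group G] [Fintype G] (d m : ℕ)
    (R : G →* Matrix.unitaryGroup (Fin d) ℂ)
    -- the orthogonal projections onto the summands V_1, ..., V_m
    (P : Fin m → Matrix (Fin d) (Fin d) ℂ)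
    (hPproj : ∀ k, P k * P k = P k)
    (hPsa : ∀ k, (P k)ᴴ = P k)
    (hPorth : ∀ k l, k ≠ l → P k * P l = 0)
    (hPsum : ∑ k, P k = 1)
    (hPinv : ∀ (g : G) k, (R g : Matrix (Fin d) (Fin d) ℂ) * P k
        = P k * (R g : Matrix (Fin d) (Fin d) ℂ))
    -- each summand is irreducible as a G-module
    (hirr : ∀ k (Q : Matrix (Fin d) (Fin d) ℂ), Q * Q = Q → Qᴴ = Q →
        Q * P k = Q → P k * Q = Q →
        (∀ g : G, (R g : Matrix (Fin d) (Fin d) ℂ) * Q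
          = Q * (R g : Matrix (Fin d) (Fin d) ℂ)) →
        Q = 0 ∨ Q = P k)
    -- an orthonormal basis adapted to the decomposition
    (w : Fin d → Fin d → ℂ)
    (horth : ∀ i j, (∑ x, star (w i x) * w j x) = if i = j then 1 else 0)
    (k : Fin d → Fin m)
    (hadapt : ∀ i, (P (k i)).mulVec (w i) = w i)
    -- an abelian subgroup H of G for which w is a non-degenerate simultaneous eigenbasis
    (H : Subgroup G)
    (hHab : ∀ a b : H, a * b = b * a)
    (χ : Fin d → H → ℂ)
    (heig : ∀ (h : H) (i : Fin d),
      ((R (h : G) : Matrix (Fin d) (Fin d) ℂ)).mulVec (w i) = χ i h • w i)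
    (hnd : ∀ i j, i ≠ j → k i = k j → χ i ≠ χ j)
    -- the target observable O = Σ_j O_j with O_j in conjugation-invariant irreducible
    -- block-preserving subspaces W_j
    (r : ℕ)
    (Oj : Fin r → Matrix (Fin d) (Fin d) ℂ)
    (W : Fin r → Submodule ℂ (Matrix (Fin d) (Fin d) ℂ))
    (hWinv : ∀ j (g : G), ∀ X ∈ W j, conjMap (R g : Matrix (Fin d) (Fin d) ℂ) X ∈ W j)
    (hWirr : ∀ j (W' : Submodule ℂ (Matrix (Fin d) (Fin d) ℂ)), W' ≤ W j →
      (∀ (g : G), ∀ X ∈ W', conjMap (R g : Matrix (Fin d) (Fin d) ℂ) X ∈ W') →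
      W' = ⊥ ∨ W' = W j)
    (hWdiag : ∀ j, ∀ X ∈ W j, ∀ l, P l * X * P l = X * P l)
    (hOmem : ∀ j, Oj j ∈ W j)
    (hOne : ∀ j, Oj j ≠ 0)
    (hOsa : ∀ j, (Oj j)ᴴ = Oj j)
    -- the visibility coefficients a_j = dim (W_j)^H / dim W_j, all positive
    (a : Fin r → ℝ)
    (ha : ∀ j, a j =
      (Module.finrank ℂ
        ↥(W j ⊓ ⨅ h : H, LinearMap.ker
            (conjMap ((R (h : G) : Matrix (Fin d) (Fin d) ℂ)) - LinearMap.id)) : ℝ) /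
      (Module.finrank ℂ ↥(W j) : ℝ))
    (hapos : ∀ j, 0 < a j)
    -- a density matrix
    (ρ : Matrix (Fin d) (Fin d) ℂ)
    (hρ : ρ.PosSemidef) (hρtr : ρ.trace = 1)
    :
    mean R w ρ (∑ j, ((a j : ℂ))⁻¹ • Oj j) = ((ρ * ∑ j, Oj j).trace).re := by
  have hA : (of w)ᵀᴴ * (of w)ᵀ = 1 := by
    ext i j
    simpa [mul_apply, one_apply] using horth i j
  have hcol {N : Matrix (Fin d) (Fin d) ℂ} (i : Fin d) (x : Fin d) :
      (N * (of w)ᵀ) x i = (N *ᵥ w i) x := by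
    simp [mul_apply, mulVec, dotProduct]
  have heig' (h : H) : (R (h : G) : Matrix (Fin d) (Fin d) ℂ) * (of w)ᵀ =
      (of w)ᵀ * diagonal fun i => χ i h := by
    ext x i
    rw [hcol, heig, mul_diagonal]
    simp [mul_comm]
  have hblock (j : Fin r) {X : Matrix (Fin d) (Fin d) ℂ} (hX : X ∈ W j) (i i' : Fin d)
      (hii' : i ≠ i') (hχ : χ i = χ i') : ((of w)ᵀᴴ * X * (of w)ᵀ) i i' = 0 := by
    have hk : k i ≠ k i' := fun h => hnd i i' hii' h hχ
    have hzero : P (k i') *ᵥ w i = 0 := by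
      rw [← hadapt i, mulVec_mulVec, hPorth _ _ hk.symm, zero_mulVec]
    rw [← sum_star_mul_mulVec]
    change star (w i) ⬝ᵥ (X *ᵥ w i') = 0
    rw [← hadapt i', mulVec_mulVec, ← hWdiag j X hX, mul_assoc, ← mulVec_mulVec,
      dotProduct_mulVec, ← hPsa, ← star_mulVec, hzero, star_zero, zero_dotProduct]
  classical
  have hcardH : (Fintype.card H : ℂ) ≠ 0 := by simp
  let _ : Invertible (Fintype.card H : ℂ) := invertibleOfNonzero hcardH
  let T : Module.End ℂ (Matrix (Fin d) (Fin d) ℂ) :=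
    Representation.averageMap ((conjRep R).comp H.subtype)
  have hscal (j : Fin r) : (conjRep R).conjAverage T (Oj j) = (a j : ℂ) • Oj j := by
    have hinv : Representation.invariants ((conjRep R).comp H.subtype) =
        ⨅ h : H, LinearMap.ker
          (conjMap ((R (h : G) : Matrix (Fin d) (Fin d) ℂ)) - LinearMap.id) := by
      ext X
      simp only [Representation.mem_invariants, Submodule.mem_iInf, LinearMap.mem_ker,
        LinearMap.sub_apply, sub_eq_zero]
      rfl
    have hne : (Module.finrank ℂ (W j) : ℂ) ≠ 0 := by
      intro h
      rw [Nat.cast_eq_zero, Submodule.finrank_eq_zero] at h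
      exact hOne j ((Submodule.eq_bot_iff _).1 h _ (hOmem j))
    have key := (conjRep R).conjAverage_averageMap_apply_of_mem (W j) (hWinv j) (hWirr j) H
      (hOmem j)
    rw [hinv] at key
    rw [ha, Complex.ofReal_div, div_eq_inv_mul, mul_smul, Complex.ofReal_natCast,
      Complex.ofReal_natCast, ← key, inv_smul_smul₀ hne]
  have hY : (∑ j, ((a j : ℂ))⁻¹ • Oj j).IsHermitian := by
    simp [IsHermitian, conjTranspose_sum, hOsa]
  have hO : (conjRep R).conjAverage T (∑ j, ((a j : ℂ))⁻¹ • Oj j) = ∑ j, Oj j := by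
    simp only [map_sum, map_smul, hscal]
    refine Finset.sum_congr rfl fun j _ => inv_smul_smul₀ ?_ _
    exact_mod_cast (hapos j).ne'
  have hTY (g : G) : dephase (of w)ᵀ (conjRep R g (∑ j, ((a j : ℂ))⁻¹ • Oj j)) =
      T (conjRep R g (∑ j, ((a j : ℂ))⁻¹ • Oj j)) := by
    refine (averageMap_conjRep_eq_dephase (R.comp H.subtype) _ hA χ heig' _
      fun i i' h h' => ?_).symm
    simp only [map_sum, map_smul, Finset.mul_sum, Finset.sum_mul, Matrix.sum_apply,
      mul_smul_comm, smul_mul_assoc, Matrix.smul_apply]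
    refine Finset.sum_eq_zero fun j _ => smul_eq_zero_of_right _ ?_
    exact hblock j (hWinv j g _ (hOmem j)) i i' h h'
  have hmean : (mean R w ρ (∑ j, ((a j : ℂ))⁻¹ • Oj j) : ℂ) = (ρ * ∑ j, Oj j).trace := by
    rw [ofReal_mean R w hρ.isHermitian hY, ← hO]
    simp only [hTY, trace_conjRep_mul]
    generalize ∑ j, ((a j : ℂ))⁻¹ • Oj j = Y
    simp [Representation.conjAverage, Finset.mul_sum, Matrix.trace_sum]
  rw [← hmean, Complex.ofReal_re]
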